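/- arXiv:1801.07025 — 5 statements merged into one kernel-verified Lean document; each statement's English description precedes it below -/
import Mathlib

section
/- Let G be a finite simple 2-connected graph and let G' be a non-empty connected subgraph of G containing all vertices of G of degree at least 4, such that G − V(G') contains at least one cycle. Then G − V(G') contains an induced cycle C of G such that G − V(C) is connected. -/
open SimpleGraph

/-- The degree of a vertex `v` in a simple graph `H`. -/
noncomputable def gdeg {V : Type} (H : SimpleGraph V) (v : V) : ℕ :=
  Nat.card (H.neighborSet v)

/-- A finite simple graph is 2-connected if it has at least 3 vertices, is connected, and
remains connected after the deletion of any single vertex. -/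
def TwoConnected {V : Type} [Fintype V] (G : SimpleGraph V) : Prop :=
  3 ≤ Fintype.card V ∧ G.Connected ∧ ∀ v : V, (G.induce {v}ᶜ).Connected

/-- A walk closing up an edge that it does not use yields a cycle inside its support. -/
lemma exists_cycle_of_walk {V : Type} {G : SimpleGraph V} {x d : V} (h : G.Adj x d)
    (w : G.Walk d x) (he : s(x, d) ∉ w.edges) :
    ∃ c : G.Walk x x, c.IsCycle ∧ ∀ z ∈ c.support, z ∈ w.support := by
  classical
  refine ⟨Walk.cons h w.bypass, ?_, ?_⟩
  · rw [Walk.cons_isCycle_iff]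
    exact ⟨w.bypass_isPath, fun h' => he (w.edges_bypass_subset_edges h')⟩
  · intro z hz
    rw [Walk.support_cons, List.mem_cons] at hz
    rcases hz with rfl | hz
    · exact w.end_mem_support
    · exact w.support_bypass_subset_support hz

/-- Two vertices of a cycle other than `b` are joined along the cycle avoiding `b`. -/
lemma exists_walk_cycle_avoid {V : Type} {G : SimpleGraph V} {u b x y : V} (c : G.Walk u u)
    (hc : c.IsCycle) (hb : b ∈ c.support) (hx : x ∈ c.support) (hy : y ∈ c.support)
    (hxb : x ≠ b) (hyb : y ≠ b) :
    ∃ w : G.Walk y x, ∀ z ∈ w.support, z ∈ c.support ∧ z ≠ b := by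
  classical
  have hc' := hc.rotate hb
  have hs : ∀ z, z ∈ (c.rotate b hb).support ↔ z ∈ c.support :=
    fun z => c.mem_support_rotate_iff b hb
  generalize c.rotate b hb = q at hc' hs
  cases q with
  | nil => exact absurd hc' (by simp)
  | cons h p =>
    have hp := ((Walk.cons_isCycle_iff _ _).1 hc').1
    have key : ∀ z, z ∈ c.support → z ≠ b → z ∈ p.support := by
      intro z hz hzb
      have := (hs z).2 hz
      rw [Walk.support_cons, List.mem_cons] at this
      exact this.resolve_left hzb
    have hxp := key x hx hxb
    have hyp := key y hy hyb
    refine ⟨(p.takeUntil y hyp).reverse.append (p.takeUntil x hxp), ?_⟩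
    intro z hz
    rw [Walk.mem_support_append_iff, Walk.support_reverse, List.mem_reverse] at hz
    have hsub : ∀ z ∈ p.support, z ∈ c.support := fun z hz => (hs z).1 (by simp [hz])
    rcases hz with hz | hz
    · refine ⟨hsub z (p.support_takeUntil_subset_support hyp hz), ?_⟩
      rintro rfl
      exact Walk.endpoint_notMem_support_takeUntil hp hyp hyb.symm hz
    · refine ⟨hsub z (p.support_takeUntil_subset_support hxp hz), ?_⟩
      rintro rfl
      exact Walk.endpoint_notMem_support_takeUntil hp hxp hxb.symm hz

/-- Any cycle avoiding `B` can be replaced with an induced one. -/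
lemma exists_induced_cycle {V : Type} {G : SimpleGraph V} (B : Set V)
    (h : ∃ (u : V) (c : G.Walk u u), c.IsCycle ∧ ∀ z ∈ c.support, z ∉ B) :
    ∃ (u : V) (c : G.Walk u u), c.IsCycle ∧ (∀ z ∈ c.support, z ∉ B) ∧
      (∀ a b : V, a ∈ c.support → b ∈ c.support → G.Adj a b → s(a, b) ∈ c.edges) := by
  classical
  have hex : ∃ n : ℕ, ∃ (u : V) (c : G.Walk u u), c.IsCycle ∧ (∀ z ∈ c.support, z ∉ B) ∧
      c.length = n := by
    obtain ⟨u, c, h1, h2⟩ := h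
    exact ⟨_, u, c, h1, h2, rfl⟩
  obtain ⟨u, c, hc, hB, hlen⟩ := Nat.find_spec hex
  refine ⟨u, c, hc, hB, ?_⟩
  intro a b ha hb hab
  by_contra hne
  have hc' := hc.rotate ha
  have hs : ∀ z, z ∈ (c.rotate a ha).support ↔ z ∈ c.support :=
    fun z => c.mem_support_rotate_iff a ha
  have hl : (c.rotate a ha).length = c.length := by
    simpa using (c.rotate_edges a ha).perm.length_eq
  have he : s(a, b) ∉ (c.rotate a ha).edges :=
    fun h' => hne ((c.rotate_edges a ha).perm.mem_iff.1 h')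
  generalize c.rotate a ha = q at hc' hs hl he
  have hbq := (hs b).2 hb
  have hspec := q.take_spec hbq
  have hlens : (q.takeUntil b hbq).length + (q.dropUntil b hbq).length = q.length := by
    rw [← Walk.length_append, hspec]
  have hd : 2 ≤ (q.dropUntil b hbq).length := by
    have hsub := q.edges_dropUntil_subset_edges hbq
    generalize q.dropUntil b hbq = r at hsub
    cases r with
    | nil => exact absurd hab (by simp)
    | cons h1 r =>
      cases r with
      | nil => exact absurd (hsub (by simp [Sym2.eq_swap])) he
      | cons h2 r => simp
  have hcyc : (Walk.cons hab.symm (q.takeUntil b hbq)).IsCycle := by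
    rw [Walk.cons_isCycle_iff]
    refine ⟨hc'.isPath_takeUntil hbq, fun h' => he ?_⟩
    rw [Sym2.eq_swap]
    exact q.edges_takeUntil_subset_edges hbq h'
  have hlt : (Walk.cons hab.symm (q.takeUntil b hbq)).length < Nat.find hex := by
    rw [Walk.length_cons, ← hlen]; omega
  refine Nat.find_min hex hlt ⟨b, _, hcyc, ?_, rfl⟩
  intro z hz
  apply hB
  rw [Walk.support_cons, List.mem_cons] at hz
  rcases hz with rfl | hz
  · exact hb
  · exact (hs z).1 (q.support_takeUntil_subset_support hbq hz)

/-- A vertex on a cycle with two different neighbours off the cycle has degree at least 4. -/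
lemma four_le_gdeg {V : Type} [Fintype V] {G : SimpleGraph V} {u b p d : V} (c : G.Walk u u)
    (hc : c.IsCycle) (hb : b ∈ c.support) (hp : p ∉ c.support) (hd : d ∉ c.support)
    (hpd : p ≠ d) (hbp : G.Adj b p) (hbd : G.Adj b d) : 4 ≤ gdeg G b := by
  classical
  have h2 := hc.ncard_neighborSet_toSubgraph_eq_two hb
  have hsub : insert p (insert d (c.toSubgraph.neighborSet b)) ⊆ G.neighborSet b := by
    intro z hz
    rcases hz with rfl | rfl | hz
    · exact hbp
    · exact hbd
    · exact c.toSubgraph.adj_sub hz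
  have hmem : ∀ z ∈ c.toSubgraph.neighborSet b, z ∈ c.support := by
    intro z hz
    exact Walk.mem_support_of_adj_toSubgraph (c.toSubgraph.adj_symm hz)
  have h3 : (insert d (c.toSubgraph.neighborSet b)).ncard = 3 := by
    rw [Set.ncard_insert_of_notMem (fun h => hd (hmem _ h)) (Set.toFinite _), h2]
  have h4 : (insert p (insert d (c.toSubgraph.neighborSet b))).ncard = 4 := by
    rw [Set.ncard_insert_of_notMem _ (Set.toFinite _), h3]
    rintro (h | h)
    · exact hpd h
    · exact hp (hmem _ h)
  have := Set.ncard_le_ncard hsub (Set.toFinite _)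
  rw [h4] at this
  exact this

/-- Let `G` be a finite simple 2-connected graph and `G'` a non-empty connected subgraph
containing all vertices of `G` of degree at least 4, such that `G − V(G')` contains a
cycle. Then `G − V(G')` contains an induced cycle `C` of `G` such that `G − V(C)` is
connected. -/
theorem stmt_10 (V : Type) [Fintype V] (G : SimpleGraph V) (h2 : TwoConnected G)
    (G' : G.Subgraph) (hne : G'.verts.Nonempty) (hG'conn : G'.Connected)
    (hbig : ∀ v, 4 ≤ gdeg G v → v ∈ G'.verts)
    (hcyc : ∃ (u : ↥(G'.vertsᶜ)) (c : (G.induce G'.vertsᶜ).Walk u u), c.IsCycle) :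
    ∃ (u : V) (c : G.Walk u u), c.IsCycle ∧
      (∀ z ∈ c.support, z ∉ G'.verts) ∧
      (∀ a b : V, a ∈ c.support → b ∈ c.support → G.Adj a b → s(a, b) ∈ c.edges) ∧
      (G.induce {z | z ∉ c.support}).Connected := by
  classical
  -- a maximal connected vertex set `B` containing `G'` whose complement contains a cycle
  let P : Set (Set V) := {B | G'.verts ⊆ B ∧ (G.induce B).Connected ∧
    ∃ (u : V) (c : G.Walk u u), c.IsCycle ∧ ∀ z ∈ c.support, z ∉ B}
  have hP : P.Nonempty := by
    refine ⟨G'.verts, subset_rfl, hG'conn.induce_verts, ?_⟩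
    obtain ⟨u, c, hc⟩ := hcyc
    refine ⟨_, c.map (Embedding.induce G'.vertsᶜ).toHom,
      hc.map (Embedding.induce (G := G) G'.vertsᶜ).injective, ?_⟩
    intro z hz
    rw [Walk.support_map, List.mem_map] at hz
    obtain ⟨y, -, rfl⟩ := hz
    exact y.2
  obtain ⟨B, ⟨hHB, hBconn, hBcyc⟩, hmax⟩ := (Set.toFinite P).exists_maximal hP
  obtain ⟨u, c, hc, hcB, hind⟩ := exists_induced_cycle B hBcyc
  -- neighbours of `B` lie on every cycle outside of `B`
  have hN : ∀ p ∈ B, ∀ b, b ∉ B → G.Adj p b → ∀ (x : V) (q : G.Walk x x), q.IsCycle →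
      (∀ z ∈ q.support, z ∉ B) → b ∈ q.support := by
    intro p hp b hb hadj x q hq hqB
    by_contra hbq
    have hmem : B ∪ {b} ∈ P := by
      refine ⟨hHB.trans Set.subset_union_left,
        connected_induce_union hBconn.preconnected ?_ hp rfl hadj, x, q, hq, ?_⟩
      · have : Subsingleton ({b} : Set V) := by infer_instance
        intro y z
        rw [Subsingleton.elim y z]
      · rintro z hz (h | h)
        · exact hqB z hz h
        · rw [Set.mem_singleton_iff] at h
          exact hbq (h ▸ hz)
    exact hb (hmax hmem Set.subset_union_left (Or.inr rfl))
  refine ⟨u, c, hc, fun z hz h => hcB z hz (hHB h), hind, ?_⟩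
  suffices hset : {z | z ∉ c.support} = B by rw [hset]; exact hBconn
  refine Set.Subset.antisymm ?_ (fun z hz h => hcB z h hz)
  intro v hv
  by_contra hvB
  -- a vertex `b` of the cycle adjacent to `B`
  obtain ⟨p0, hp0⟩ := hne
  obtain ⟨w0⟩ := h2.2.1.preconnected p0 u
  obtain ⟨e, -, hpB, hbB⟩ := w0.exists_boundary_dart B (hHB hp0) (hcB u c.start_mem_support)
  obtain ⟨⟨p, b⟩, hpb⟩ := e
  dsimp only at hpB hbB hpb
  have hbc : b ∈ c.support := hN p hpB b hbB hpb u c hc hcB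
  -- the component `D` of `v`
  let D : Set V := {z | ∃ w : G.Walk v z, ∀ y ∈ w.support, y ∉ B ∧ y ∉ c.support}
  have hvD : v ∈ D := ⟨Walk.nil, by
    intro y hy
    rw [Walk.support_nil, List.mem_singleton] at hy
    subst hy
    exact ⟨hvB, hv⟩⟩
  have hD : ∀ z ∈ D, z ∉ B ∧ z ∉ c.support := fun z ⟨w, hw⟩ => hw z w.end_mem_support
  have hbD : b ∉ D := fun h => (hD b h).2 hbc
  have hexit : ∀ d ∈ D, ∀ x, x ∉ D → G.Adj d x → x ∈ c.support ∧ x ≠ b := by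
    intro d hd x hx hdx
    have hxB : x ∉ B := fun h => (hD d hd).2 (hN x h d (hD d hd).1 hdx.symm u c hc hcB)
    have hxc : x ∈ c.support := by
      by_contra hxc
      obtain ⟨w, hw⟩ := hd
      refine hx ⟨w.concat hdx, ?_⟩
      intro y hy
      simp only [Walk.support_concat, List.concat_eq_append, List.mem_append, List.mem_singleton] at hy
      rcases hy with hy | rfl
      · exact hw y hy
      · exact ⟨hxB, hxc⟩
    refine ⟨hxc, ?_⟩
    rintro rfl
    have := four_le_gdeg c hc hbc (fun h => hcB p h hpB) (hD d hd).2
      (fun h => (hD d hd).1 (h ▸ hpB)) hpb.symm hdx.symm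
    exact hbB (hHB (hbig _ this))
  -- first attachment
  obtain ⟨w1⟩ := h2.2.1.preconnected v b
  obtain ⟨⟨⟨d, x⟩, hdx⟩, -, hdD, hxD⟩ := w1.exists_boundary_dart D hvD hbD
  dsimp only at hdD hxD hdx
  obtain ⟨hxc, hxb⟩ := hexit d hdD x hxD hdx
  -- second attachment
  have hvx : v ≠ x := fun h => hxD (h ▸ hvD)
  obtain ⟨w2⟩ := (h2.2.2 x).preconnected ⟨v, hvx⟩ ⟨b, hxb.symm⟩
  obtain ⟨⟨⟨d', y⟩, hdy⟩, -, hdD', hyD⟩ :=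
    w2.exists_boundary_dart (Subtype.val ⁻¹' D) hvD hbD
  obtain ⟨d', hd'x⟩ := d'
  obtain ⟨y, hyx⟩ := y
  have hdy' : G.Adj d' y := hdy
  have hd'D : d' ∈ D := hdD'
  have hyD' : y ∉ D := hyD
  have hyx' : y ≠ x := hyx
  obtain ⟨hyc, hyb⟩ := hexit d' hd'D y hyD' hdy'
  obtain ⟨r, hr⟩ := exists_walk_cycle_avoid c hc hbc hxc hyc hxb hyb
  obtain ⟨s1, hs1⟩ := hdD
  obtain ⟨s2, hs2⟩ := hd'D
  have hdc : d ∉ c.support := (hs1 d s1.end_mem_support).2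
  have hd'c : d' ∉ c.support := (hs2 d' s2.end_mem_support).2
  let s3 : G.Walk d d' := s1.reverse.append s2
  have hs3 : ∀ z ∈ s3.support, z ∉ B ∧ z ∉ c.support := by
    intro z hz
    rw [Walk.mem_support_append_iff, Walk.support_reverse, List.mem_reverse] at hz
    exact hz.elim (hs1 z) (hs2 z)
  obtain ⟨q, hq, hqs⟩ := exists_cycle_of_walk hdx.symm (s3.append (Walk.cons hdy' r)) (by
    intro h
    rw [Walk.edges_append, List.mem_append, Walk.edges_cons, List.mem_cons] at h
    rcases h with h | h | h
    · exact (hs3 x (s3.fst_mem_support_of_mem_edges h)).2 hxc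
    · rw [Sym2.eq_iff] at h
      rcases h with ⟨h, -⟩ | ⟨h, -⟩
      · exact hd'c (h ▸ hxc)
      · exact hyx' h.symm
    · exact hdc (hr d (r.snd_mem_support_of_mem_edges h)).1)
  have hq' : ∀ z ∈ q.support, z ∉ B ∧ z ≠ b := by
    intro z hz
    have hz' := hqs z hz
    rw [Walk.mem_support_append_iff, Walk.support_cons, List.mem_cons] at hz'
    have hcase : ∀ z ∈ s3.support, z ∉ B ∧ z ≠ b :=
      fun z h => ⟨(hs3 z h).1, fun h' => (hs3 z h).2 (h' ▸ hbc)⟩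
    rcases hz' with h | h | h
    · exact hcase z h
    · exact hcase z (h ▸ s3.end_mem_support)
    · exact ⟨hcB z (hr z h).1, (hr z h).2⟩
  exact (hq' b (hN p hpB b hbB hpb x q hq (fun z hz => (hq' z hz).1))).2 rfl
end

section
/- Let G be a finite simple 3-edge-connected graph and let v_1, v_2 be any two vertices of G. Then there exists an induced path P in G from v_1 to v_2 such that G − E(P) is connected. -/
open SimpleGraph

/-- A graph is 3-edge-connected if it is connected and remains connected after deleting
any set of at most 2 edges. -/
def ThreeEdgeConnected {V : Type} (G : SimpleGraph V) : Prop :=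
  G.Connected ∧ ∀ E : Set (Sym2 V), E.ncard ≤ 2 → (G.deleteEdges E).Connected

lemma reach_closed {V : Type} {A B : SimpleGraph V} (X : Set V)
    (h : ∀ x y, x ∈ X → A.Adj x y → y ∈ X ∧ B.Reachable x y) {x y : V} (hx : x ∈ X)
    (hr : A.Reachable x y) : y ∈ X ∧ B.Reachable x y := by
  obtain ⟨w⟩ := hr
  induction w with
  | nil => exact ⟨hx, Reachable.refl _⟩
  | cons hadj _ ih =>
    obtain ⟨h1, h2⟩ := h _ _ hx hadj
    exact ⟨(ih h1).1, h2.trans (ih h1).2⟩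

lemma exists_edge_index {V : Type} {G : SimpleGraph V} {u v x y : V} (P : G.Walk u v)
    (h : s(x, y) ∈ P.edges) : ∃ q, q < P.length ∧
      ((P.getVert q = x ∧ P.getVert (q + 1) = y) ∨
        (P.getVert q = y ∧ P.getVert (q + 1) = x)) := by
  rw [← Walk.adj_toSubgraph_iff_mem_edges, Walk.toSubgraph_adj_iff] at h
  obtain ⟨i, h1, h2⟩ := h
  refine ⟨i, h2, ?_⟩
  simpa using h1

lemma edge_index_mem {V : Type} {G : SimpleGraph V} {u v : V} (P : G.Walk u v) {q : ℕ}
    (h : q < P.length) : s(P.getVert q, P.getVert (q + 1)) ∈ P.edges := by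
  rw [← Walk.adj_toSubgraph_iff_mem_edges, Walk.toSubgraph_adj_iff]
  exact ⟨q, rfl, h⟩

/-- A path all of whose chords are its own edges. -/
def IsIndPath {V : Type} {G : SimpleGraph V} {u v : V} (P : G.Walk u v) : Prop :=
  P.IsPath ∧ ∀ a b : V, a ∈ P.support → b ∈ P.support → G.Adj a b → s(a, b) ∈ P.edges

lemma exists_indPath {V : Type} {K : SimpleGraph V} {u v : V} (h : K.Reachable u v) :
    ∃ P : K.Walk u v, IsIndPath P := by
  obtain ⟨P, hP, hd⟩ := h.exists_path_of_dist
  refine ⟨P, hP, ?_⟩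
  have key : ∀ i j, i ≤ P.length → j ≤ P.length → i < j → K.Adj (P.getVert i) (P.getVert j) →
      s(P.getVert i, P.getVert j) ∈ P.edges := by
    intro i j hi hj hij hadj
    have h1 := dist_le ((P.take i).append (Walk.cons hadj (P.drop j)))
    simp only [Walk.length_append, Walk.length_cons, Walk.take_length, Walk.drop_length] at h1
    have : j = i + 1 := by
      have := min_le_left i P.length
      omega
    subst this
    exact edge_index_mem P (by omega)
  intro a b ha hb hab
  rw [Walk.mem_support_iff_exists_getVert] at ha hb
  obtain ⟨i, rfl, hi⟩ := ha
  obtain ⟨j, rfl, hj⟩ := hb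
  rcases lt_trichotomy i j with hij | hij | hij
  · exact key i j hi hj hij hab
  · subst hij; exact absurd hab (K.irrefl)
  · rw [Sym2.eq_swap]; exact key j i hj hi hij hab.symm

/-- `G` with only the edges inside `S`. -/
def inside {V : Type} (G : SimpleGraph V) (S : Set V) : SimpleGraph V where
  Adj x y := G.Adj x y ∧ x ∈ S ∧ y ∈ S
  symm := ⟨fun _ _ h => ⟨h.1.symm, h.2.2, h.2.1⟩⟩
  loopless := ⟨fun _ h => G.irrefl h.1⟩

lemma exists_indPath_inside {V : Type} {G : SimpleGraph V} (S : Set V) {u v : V} (hu : u ∈ S)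
    (h : (inside G S).Reachable u v) :
    ∃ P : G.Walk u v, IsIndPath P ∧ ∀ x y, s(x, y) ∈ P.edges → x ∈ S ∧ y ∈ S := by
  classical
  obtain ⟨P, hP, hI⟩ := exists_indPath h
  have hle : inside G S ≤ G := fun x y h => h.1
  have hS : ∀ x ∈ P.support, x ∈ S := by
    intro x hx
    exact (reach_closed (A := inside G S) (B := inside G S) S
      (fun x y _ h => ⟨h.2.2, h.reachable⟩) hu (P.takeUntil x hx).reachable).1
  refine ⟨P.mapLe hle, ⟨hP.mapLe hle, ?_⟩, ?_⟩
  · intro a b ha hb hab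
    rw [Walk.support_mapLe_eq_support] at ha hb
    rw [Walk.edges_mapLe_eq_edges]
    exact hI a b ha hb ⟨hab, hS a ha, hS b hb⟩
  · intro x y hxy
    rw [Walk.edges_mapLe_eq_edges] at hxy
    exact (P.adj_of_mem_edges hxy).2

lemma crossing {V : Type} {G : SimpleGraph V}
    (h3 : ThreeEdgeConnected G) {v₁ v₂ : V} (P : G.Walk v₁ v₂) (H : SimpleGraph V)
    (hH : H = G.deleteEdges {e | e ∈ P.edges}) (hn : ¬ H.Connected) :
    ∃ m l k, m < l ∧ l < k ∧ k ≤ P.length ∧ H.Reachable v₁ (P.getVert l) ∧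
      H.Reachable (P.getVert m) (P.getVert k) ∧ ¬ H.Reachable v₁ (P.getVert m) := by
  classical
  have hHadj : ∀ x y, G.Adj x y → s(x, y) ∉ P.edges → H.Adj x y := by
    intro x y h1 h2
    rw [hH, deleteEdges_adj]; exact ⟨h1, h2⟩
  by_contra hno
  push Not at hno
  have hw : ∃ w, ¬ H.Reachable v₁ w := by
    by_contra hcon
    push Not at hcon
    exact hn ((connected_iff_exists_forall_reachable H).2 ⟨v₁, hcon⟩)
  obtain ⟨w, hw⟩ := hw
  have hi : ∃ i, i ≤ P.length ∧ ¬ H.Reachable v₁ (P.getVert i) := by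
    by_contra hcon
    push Not at hcon
    apply hw
    refine (reach_closed (A := G) (B := G) {x | H.Reachable v₁ x} ?_ (Reachable.refl v₁)
      (h3.1.preconnected v₁ w)).1
    intro x y hx hxy
    refine ⟨?_, hxy.reachable⟩
    by_cases he : s(x, y) ∈ P.edges
    · obtain ⟨q, hq, ⟨rfl, rfl⟩ | ⟨rfl, rfl⟩⟩ := exists_edge_index P he
      · exact hcon _ (by omega)
      · exact hcon _ (by omega)
    · exact Reachable.trans hx (hHadj x y hxy he).reachable
  obtain ⟨i, hin, hi⟩ := hi
  have h0 : H.Reachable v₁ (P.getVert 0) := by rw [Walk.getVert_zero]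
  -- the last index in the root component before `i`
  obtain ⟨lo, hlo, hloC, hlo'⟩ : ∃ lo, lo < i ∧ H.Reachable v₁ (P.getVert lo) ∧
      ∀ t, lo < t → t ≤ i → ¬ H.Reachable v₁ (P.getVert t) := by
    have hs := Nat.findGreatest_spec (P := fun t => H.Reachable v₁ (P.getVert t)) (Nat.zero_le i) h0
    have hle := Nat.findGreatest_le (P := fun t => H.Reachable v₁ (P.getVert t)) i
    refine ⟨_, lt_of_le_of_ne hle ?_, hs, fun t h1 h2 => Nat.findGreatest_is_greatest h1 h2⟩
    intro he
    rw [he] at hs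
    exact hi hs
  -- the first index in the root component after `i`
  obtain ⟨hi', hgt, hiC, hbet⟩ : ∃ b, i < b ∧
      (b ≤ P.length → H.Reachable v₁ (P.getVert b)) ∧
      ∀ t, i ≤ t → t < b → t ≤ P.length ∧ ¬ H.Reachable v₁ (P.getVert t) := by
    have hex : ∃ b, i ≤ b ∧ (b ≤ P.length → H.Reachable v₁ (P.getVert b)) :=
      ⟨P.length + 1, by omega, by omega⟩
    have hs := Nat.find_spec hex
    refine ⟨Nat.find hex, lt_of_le_of_ne hs.1 ?_, hs.2, ?_⟩
    · intro he
      exact hi (by have := hs.2; rw [← he] at this; exact this hin)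
    · intro t h1 h2
      have := Nat.find_min hex h2
      push Not at this
      exact this h1
  have hgap : ∀ t, lo < t → t < hi' → t ≤ P.length ∧ ¬ H.Reachable v₁ (P.getVert t) := by
    intro t h1 h2
    rcases le_total t i with h | h
    · exact ⟨by omega, hlo' t h1 h⟩
    · exact hbet t h h2
  let E : Set (Sym2 V) :=
    {s(P.getVert lo, P.getVert (lo + 1)), s(P.getVert (hi' - 1), P.getVert hi')}
  have hE := h3.2 E ((Set.ncard_insert_le _ _).trans (by rw [Set.ncard_singleton]))
  let X : Set V := {x | ∃ t, lo < t ∧ t < hi' ∧ H.Reachable (P.getVert t) x}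
  have hXr : ∀ r, r ≤ P.length → P.getVert r ∈ X → lo < r ∧ r < hi' := by
    rintro r hr ⟨t, h1, h2, h4⟩
    obtain ⟨h5, h6⟩ := hgap t h1 h2
    have hrC : ¬ H.Reachable v₁ (P.getVert r) := fun h => h6 (h.trans h4.symm)
    constructor
    · by_contra hc
      rcases Nat.lt_or_ge r lo with h | h
      · exact hrC (hno r lo t h h1 h5 hloC h4.symm)
      · have : r = lo := by omega
        exact hrC (this ▸ hloC)
    · by_contra hc
      rcases Nat.lt_or_ge hi' r with h | h
      · exact h6 (hno t hi' r h2 h hr (hiC (by omega)) h4)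
      · have : r = hi' := by omega
        subst this
        exact hrC (hiC hr)
  have hfin : v₁ ∈ X := by
    refine (reach_closed (A := G.deleteEdges E) (B := G.deleteEdges E) X ?_
      (⟨i, hlo, hgt, Reachable.refl _⟩ : P.getVert i ∈ X) (hE.preconnected _ v₁)).1
    intro x y hx hxy
    refine ⟨?_, hxy.reachable⟩
    rw [deleteEdges_adj] at hxy
    obtain ⟨hG, hnE⟩ := hxy
    by_cases he : s(x, y) ∈ P.edges
    · obtain ⟨q, hq, ⟨rfl, rfl⟩ | ⟨rfl, rfl⟩⟩ := exists_edge_index P he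
      · obtain ⟨h1, h2⟩ := hXr q (by omega) hx
        refine ⟨q + 1, by omega, lt_of_le_of_ne h2 ?_, Reachable.refl _⟩
        intro hq'
        apply hnE
        right
        simp [← hq']
      · obtain ⟨h1, h2⟩ := hXr (q + 1) (by omega) hx
        refine ⟨q, lt_of_le_of_ne (by omega) ?_, by omega, Reachable.refl _⟩
        intro hq'
        apply hnE
        left
        rw [hq', Sym2.eq_swap]
    · obtain ⟨t, h1, h2, h4⟩ := hx
      exact ⟨t, h1, h2, h4.trans (hHadj x y hG he).reachable⟩
  obtain ⟨t, h1, h2, h4⟩ := hfin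
  exact (hgap t h1 h2).2 h4.symm

lemma improve {V : Type} {G : SimpleGraph V}
    (h3 : ThreeEdgeConnected G) {v₁ v₂ : V} (P : G.Walk v₁ v₂) (hP : IsIndPath P)
    (hn : ¬ (G.deleteEdges {e | e ∈ P.edges}).Connected) :
    ∃ P' : G.Walk v₁ v₂, IsIndPath P' ∧
      {x | (G.deleteEdges {e | e ∈ P.edges}).Reachable v₁ x} <
        {x | (G.deleteEdges {e | e ∈ P'.edges}).Reachable v₁ x} := by
  classical
  obtain ⟨H, hH⟩ : ∃ H, H = G.deleteEdges {e | e ∈ P.edges} := ⟨_, rfl⟩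
  rw [← hH] at hn ⊢
  have hHG : ∀ x y, H.Adj x y → G.Adj x y ∧ s(x, y) ∉ P.edges := by
    intro x y h
    rw [hH, deleteEdges_adj] at h; exact h
  obtain ⟨m₀, l, k, hm₀, hlk, hk, hl, hmk₀, hmC₀⟩ := crossing h3 P H hH hn
  obtain ⟨m, hm, hmk, hmax⟩ : ∃ m, m < l ∧ H.Reachable (P.getVert m) (P.getVert k) ∧
      ∀ t, m < t → t ≤ l → ¬ H.Reachable (P.getVert t) (P.getVert k) := by
    have hs := Nat.findGreatest_spec (P := fun t => H.Reachable (P.getVert t) (P.getVert k))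
      hm₀.le hmk₀
    have hle := Nat.findGreatest_le (P := fun t => H.Reachable (P.getVert t) (P.getVert k)) l
    refine ⟨_, lt_of_le_of_ne hle ?_, hs, fun t h1 h2 => Nat.findGreatest_is_greatest h1 h2⟩
    intro he
    rw [he] at hs
    exact hmC₀ (hl.trans (hs.trans hmk₀.symm))
  have hmC : ¬ H.Reachable v₁ (P.getVert m) :=
    fun h => hmC₀ (h.trans (hmk.trans hmk₀.symm))
  let S : Set V := {x | (∃ t, t ≤ m ∧ P.getVert t = x) ∨ H.Reachable (P.getVert m) x ∨
    (∃ t, k ≤ t ∧ t ≤ P.length ∧ P.getVert t = x)}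
  have hSl : ∀ t, t ≤ m → P.getVert t ∈ S := fun t h => Or.inl ⟨t, h, rfl⟩
  have hSr : ∀ t, k ≤ t → t ≤ P.length → P.getVert t ∈ S :=
    fun t h h' => Or.inr (Or.inr ⟨t, h, h', rfl⟩)
  have r1 : ∀ t, t ≤ m → (inside G S).Reachable v₁ (P.getVert t) := by
    intro t
    induction t with
    | zero => intro _; rw [Walk.getVert_zero]
    | succ t ih =>
      intro h
      refine (ih (by omega)).trans (Adj.reachable ?_)
      exact ⟨P.adj_getVert_succ (by omega), hSl _ (by omega), hSl _ h⟩
  have r2 : (inside G S).Reachable (P.getVert m) (P.getVert k) := by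
    refine (reach_closed (A := H) {x | H.Reachable (P.getVert m) x} ?_ (Reachable.refl _) hmk).2
    intro x y hx hxy
    have hy : H.Reachable (P.getVert m) y := Reachable.trans hx hxy.reachable
    exact ⟨hy, Adj.reachable ⟨(hHG x y hxy).1, Or.inr (Or.inl hx), Or.inr (Or.inl hy)⟩⟩
  have r3 : ∀ d, k + d ≤ P.length →
      (inside G S).Reachable (P.getVert k) (P.getVert (k + d)) := by
    intro d
    induction d with
    | zero => intro _; exact Reachable.refl _
    | succ d ih =>
      intro h
      refine (ih (by omega)).trans (Adj.reachable ?_)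
      exact ⟨P.adj_getVert_succ (by omega), hSr _ (by omega) (by omega), hSr _ (by omega) h⟩
  have r : (inside G S).Reachable v₁ v₂ := by
    have h := r3 (P.length - k) (by omega)
    rw [show k + (P.length - k) = P.length by omega, Walk.getVert_length] at h
    exact ((r1 m le_rfl).trans r2).trans h
  have hv₁ : v₁ ∈ S := by
    have := hSl 0 (by omega)
    rwa [Walk.getVert_zero] at this
  obtain ⟨P', hP', hS⟩ := exists_indPath_inside S hv₁ r
  refine ⟨P', hP', ?_⟩
  obtain ⟨H', hH'⟩ : ∃ H, H = G.deleteEdges {e | e ∈ P'.edges} := ⟨_, rfl⟩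
  rw [← hH']
  have hH'adj : ∀ x y, G.Adj x y → s(x, y) ∉ P'.edges → H'.Adj x y := by
    intro x y h1 h2
    rw [hH', deleteEdges_adj]; exact ⟨h1, h2⟩
  have hSC : ∀ x, H.Reachable v₁ x → x ∈ S → x ∈ P.support := by
    rintro x hx (⟨t, _, rfl⟩ | h | ⟨t, _, _, rfl⟩)
    · exact P.getVert_mem_support t
    · exact absurd (hx.trans h.symm) hmC
    · exact P.getVert_mem_support t
  have hsub : ∀ x, H.Reachable v₁ x → H'.Reachable v₁ x := by
    intro x hx
    refine (reach_closed (A := H) {x | H.Reachable v₁ x} ?_ (Reachable.refl _) hx).2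
    intro x y hx hxy
    have hy : H.Reachable v₁ y := Reachable.trans hx hxy.reachable
    refine ⟨hy, Adj.reachable (hH'adj x y (hHG x y hxy).1 ?_)⟩
    intro he
    obtain ⟨h1, h2⟩ := hS x y he
    exact (hHG x y hxy).2 (hP.2 x y (hSC x hx h1) (hSC y hy h2) (hHG x y hxy).1)
  have hnS : ∀ t, m < t → t ≤ l → P.getVert t ∉ S := by
    rintro t h1 h2 (⟨t', h, he⟩ | h | ⟨t', h, h', he⟩)
    · have := hP.1.getVert_injOn (show t' ≤ P.length by omega) (show t ≤ P.length by omega) he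
      omega
    · exact hmax t h1 h2 (h.symm.trans hmk)
    · have := hP.1.getVert_injOn (show t' ≤ P.length by omega) (show t ≤ P.length by omega) he
      omega
  have hdown : ∀ d, m + d ≤ l → H'.Reachable (P.getVert m) (P.getVert (m + d)) := by
    intro d
    induction d with
    | zero => intro _; exact Reachable.refl _
    | succ d ih =>
      intro h
      refine (ih (by omega)).trans (Adj.reachable ?_)
      refine hH'adj _ _ (P.adj_getVert_succ (by omega)) ?_
      intro he
      exact hnS (m + d + 1) (by omega) (by omega) (hS _ _ he).2
  refine (Set.ssubset_iff_of_subset hsub).2 ⟨P.getVert m, ?_, hmC⟩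
  have h := hdown (l - m) (by omega)
  rw [show m + (l - m) = l by omega] at h
  exact (hsub _ hl).trans h.symm

/-- For any two vertices `v₁, v₂` of a finite simple 3-edge-connected graph `G`, there
exists an induced path `P` from `v₁` to `v₂` such that `G − E(P)` is connected. -/
theorem stmt_11 (V : Type) [Fintype V] (G : SimpleGraph V)
    (h3 : ThreeEdgeConnected G) (v₁ v₂ : V) :
    ∃ P : G.Walk v₁ v₂, P.IsPath ∧
      (∀ a b : V, a ∈ P.support → b ∈ P.support → G.Adj a b → s(a, b) ∈ P.edges) ∧
      (G.deleteEdges {e | e ∈ P.edges}).Connected := by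
  have key : ∀ C : Set V, ∀ P : G.Walk v₁ v₂, IsIndPath P →
      {x | (G.deleteEdges {e | e ∈ P.edges}).Reachable v₁ x} = C →
      ∃ P : G.Walk v₁ v₂, IsIndPath P ∧ (G.deleteEdges {e | e ∈ P.edges}).Connected := by
    intro C
    induction C using WellFoundedGT.induction with
    | ind C ih =>
      intro P hP hC
      by_cases hn : (G.deleteEdges {e | e ∈ P.edges}).Connected
      · exact ⟨P, hP, hn⟩
      · obtain ⟨P', hP', hlt⟩ := improve h3 P hP hn
        rw [hC] at hlt
        exact ih _ hlt P' hP' rfl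
  obtain ⟨P₀, hP₀⟩ := exists_indPath (h3.1.preconnected v₁ v₂)
  obtain ⟨P, hP, hc⟩ := key _ P₀ hP₀ rfl
  exact ⟨P, hP.1, hP.2, hc⟩
end

section
/- Every finite simple connected graph G with minimum degree at least 3 contains an induced cycle C such that G − V(C) is connected. -/
open SimpleGraph

lemma acyclic_edges_le {W : Type} [Fintype W] [Nonempty W] (K : SimpleGraph W)
    [Fintype K.edgeSet] (h : K.IsAcyclic) : K.edgeFinset.card + 1 ≤ Fintype.card W := by
  classical
  obtain ⟨F, hKF, -, hF⟩ := (connected_top (V := W)).exists_isTree_le_of_le_of_isAcyclic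
    (le_top : K ≤ ⊤) h
  rw [← hF.card_edgeFinset]
  have := Finset.card_le_card (edgeFinset_mono hKF)
  omega

open Classical in
lemma edges_bound {W : Type} [Fintype W] (K : SimpleGraph W) (a : W)
    (ha : 1 ≤ K.degree a) (h : (K.induce {a}ᶜ).IsAcyclic) :
    K.edgeFinset.card + 2 ≤ Fintype.card W + K.degree a := by
  obtain ⟨b, hb⟩ := (K.degree_pos_iff_exists_adj a).1 ha
  have : Nonempty ↥({a}ᶜ : Set W) := ⟨⟨b, hb.ne'⟩⟩
  have h1 := acyclic_edges_le _ h
  rw [card_edgeFinset_induce_compl_singleton, card_edgeFinset_deleteIncidenceSet] at h1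
  have h2 := Fintype.card_compl_set ({a} : Set W)
  have h4 : Fintype.card ↥({a} : Set W) = 1 := Fintype.card_unique
  have h3 : 1 < Fintype.card W := Fintype.one_lt_card_iff.2 ⟨a, b, hb.ne⟩
  have h5 : Fintype.card ↥({a}ᶜ : Set W) + 1 = Fintype.card W := by
    rw [h4] at h2
    have h6 : Fintype.card ↥({a}ᶜ : Set W) = Fintype.card W - 1 := by
      rw [← h2]
    omega
  omega

open Classical in
lemma not_acyclic_del {W : Type} [Fintype W] (K : SimpleGraph W) (a : W)
    (ha : 1 ≤ K.degree a) (hd : ∀ v, v ≠ a → 3 ≤ K.degree v) :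
    ¬ (K.induce {a}ᶜ).IsAcyclic := by
  intro h
  have h1 := edges_bound K a ha h
  have h2 := K.sum_degrees_eq_twice_card_edges
  rw [← Finset.add_sum_erase _ _ (Finset.mem_univ a)] at h2
  have h3 : (Finset.univ.erase a).card * 3 ≤ ∑ v ∈ Finset.univ.erase a, K.degree v := by
    rw [← smul_eq_mul]
    exact Finset.card_nsmul_le_sum _ _ _ (fun v hv => hd v (Finset.ne_of_mem_erase hv))
  rw [Finset.card_erase_of_mem (Finset.mem_univ a), Finset.card_univ] at h3
  have h4 := K.degree_lt_card_verts a
  omega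

open Classical in
lemma core {W : Type} [Fintype W] (K : SimpleGraph W) (A : Finset W) (hne : A.Nonempty)
    (hcyc : ¬ K.IsAcyclic) (hA : ∀ a ∈ A, (K.induce {a}ᶜ).IsAcyclic)
    (hd : ∀ v, v ∉ A → 3 ≤ K.degree v) :
    ∃ (u : W) (c : K.Walk u u), c.IsCycle ∧ (∀ w, w ∈ c.support) ∧
      ∀ a b, K.Adj a b → s(a, b) ∈ c.edges := by
  obtain ⟨u, c, hc⟩ : ∃ (u : W) (c : K.Walk u u), c.IsCycle := by
    simpa [IsAcyclic] using hcyc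
  have hmem : ∀ a ∈ A, a ∈ c.support := by
    intro a ha
    by_contra hn
    have hw : ∀ x ∈ c.support, x ∈ ({a}ᶜ : Set W) := by
      rintro x hx rfl
      exact hn hx
    refine hA a ha (c.induce _ hw) ?_
    refine Walk.IsCycle.of_map (f := (Embedding.induce ({a}ᶜ : Set W)).toHom) ?_
    rw [Walk.map_induce]
    exact hc
  have hsub : ∀ v, c.toSubgraph.neighborSet v ⊆ K.neighborSet v :=
    fun v => c.toSubgraph.neighborSet_subset v
  have hcard : ∀ v, (K.neighborSet v).ncard = K.degree v := by
    intro v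
    rw [Set.ncard_eq_toFinset_card', ← card_neighborFinset_eq_degree]
    rfl
  have h2 : ∀ v ∈ c.support, 2 ≤ K.degree v := by
    intro v hv
    rw [← hc.ncard_neighborSet_toSubgraph_eq_two hv, ← hcard]
    exact Set.ncard_le_ncard (hsub v) (Set.toFinite _)
  have h2A : ∀ v ∈ A, 2 ≤ K.degree v := fun v hv => h2 v (hmem v hv)
  have hsum := K.sum_degrees_eq_twice_card_edges
  rw [← Finset.sum_add_sum_compl A] at hsum
  have hSA : A.card * 2 ≤ ∑ v ∈ A, K.degree v := by
    rw [← smul_eq_mul]; exact Finset.card_nsmul_le_sum _ _ _ h2A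
  have hSZ : Aᶜ.card * 3 ≤ ∑ v ∈ Aᶜ, K.degree v := by
    rw [← smul_eq_mul]
    exact Finset.card_nsmul_le_sum _ _ _ (fun v hv => hd v (Finset.mem_compl.1 hv))
  have hn : A.card + Aᶜ.card = Fintype.card W := Finset.card_add_card_compl A
  have hE : A.card * (K.edgeFinset.card + 2) ≤
      A.card * Fintype.card W + ∑ v ∈ A, K.degree v := by
    have : ∑ v ∈ A, (K.edgeFinset.card + 2) ≤ ∑ v ∈ A, (Fintype.card W + K.degree v) :=
      Finset.sum_le_sum (fun v hv => edges_bound K v (by have := h2A v hv; omega) (hA v hv))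
    simpa [Finset.sum_add_distrib] using this
  have hp : 2 ≤ A.card := by
    by_contra hlt
    have h1 : A.card = 1 := by have := hne.card_pos; omega
    obtain ⟨a, rfl⟩ := Finset.card_eq_one.1 h1
    refine not_acyclic_del K a (by have := h2A a (by simp); omega)
      (fun v hv => hd v (by simpa using hv)) (hA a (by simp))
  have hdegA : ∀ v ∈ A, K.degree v < Fintype.card W := fun v _ => K.degree_lt_card_verts v
  have hz : Aᶜ.card = 0 ∧ (3 ≤ A.card → K.edgeFinset.card ≤ A.card) := by
    generalize (∑ v ∈ A, K.degree v) = SA at *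
    generalize (∑ v ∈ Aᶜ, K.degree v) = SZ at *
    generalize Aᶜ.card = z at *
    generalize K.edgeFinset.card = e at *
    generalize A.card = p at *
    rw [← hn] at hE
    clear hn hdegA hmem hA hd hne h2A
    obtain ⟨q, rfl⟩ := Nat.exists_eq_add_of_le hp
    have hz0 : z = 0 := by
      have : q * (2 * (2 + q) + 3 * z) ≤ q * (2 * e) := Nat.mul_le_mul_left q (by omega)
      nlinarith
    refine ⟨hz0, fun h3 => ?_⟩
    subst hz0
    by_contra hlt
    push Not at hlt
    have : q * (2 + q + 1) ≤ q * e := Nat.mul_le_mul_left q hlt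
    nlinarith
  obtain ⟨hz0, he⟩ := hz
  have hall : ∀ v, v ∈ A := by
    intro v
    have := Finset.card_eq_zero.1 hz0
    by_contra hv
    have h : v ∈ Aᶜ := Finset.mem_compl.2 hv
    rw [this] at h
    simp at h
  have hp3 : 3 ≤ A.card := by
    obtain ⟨a, ha⟩ := hne
    have h1 := hdegA a ha
    have h3 := h2A a ha
    omega
  have he := he hp3
  have hdeg2 : ∀ v, K.degree v = 2 := by
    intro v
    have hle : ∑ v ∈ A, K.degree v = ∑ v ∈ A, 2 := by
      have : ∑ v ∈ A, 2 = A.card * 2 := by simp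
      omega
    exact ((Finset.sum_eq_sum_iff_of_le h2A).1 hle.symm v (hall v)).symm
  refine ⟨u, c, hc, fun w => hmem w (hall w), fun a b hab => ?_⟩
  have heq : c.toSubgraph.neighborSet a = K.neighborSet a := by
    refine Set.eq_of_subset_of_ncard_le (hsub a) ?_ (Set.toFinite _)
    rw [hc.ncard_neighborSet_toSubgraph_eq_two (hmem a (hall a)), hcard, hdeg2]
  have : b ∈ c.toSubgraph.neighborSet a := by rw [heq]; exact hab
  exact Walk.adj_toSubgraph_iff_mem_edges.1 this

/-- (Thomassen–Toft) Every finite simple connected graph `G` with minimum degree at least 3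
contains an induced cycle `C` such that `G − V(C)` is connected. -/
theorem stmt_12 (V : Type) [Fintype V] (G : SimpleGraph V)
    (hconn : G.Connected) (hdeg : ∀ v, 3 ≤ gdeg G v) :
    ∃ (u : V) (c : G.Walk u u), c.IsCycle ∧
      (∀ a b : V, a ∈ c.support → b ∈ c.support → G.Adj a b → s(a, b) ∈ c.edges) ∧
      (G.induce {z | z ∉ c.support}).Connected := by
  classical
  have hdeg' : ∀ v, 3 ≤ G.degree v := by
    intro v
    have := hdeg v
    rwa [gdeg, Nat.card_eq_fintype_card, card_neighborSet_eq_degree] at this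
  obtain ⟨v0⟩ := hconn.nonempty
  let P : Set (Set V) := {B | (G.induce B).Connected ∧ ¬ (G.induce Bᶜ).IsAcyclic}
  have hP0 : ({v0} : Set V) ∈ P := by
    refine ⟨?_, not_acyclic_del G v0 (by have := hdeg' v0; omega) (fun v _ => hdeg' v)⟩
    have : Nonempty ↥({v0} : Set V) := ⟨⟨v0, rfl⟩⟩
    exact ⟨fun x y => by rw [Subsingleton.elim x y]⟩
  obtain ⟨B, hB⟩ := (Set.toFinite P).exists_maximal ⟨_, hP0⟩
  obtain ⟨hBc, hBa⟩ := hB.prop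
  obtain ⟨⟨b0, hb0⟩⟩ := hBc.nonempty
  -- the attachments
  let A : Finset ↥(Bᶜ) := Finset.univ.filter (fun x => ∃ b ∈ B, G.Adj b x)
  have hAne : A.Nonempty := by
    obtain ⟨u, c, hc⟩ : ∃ (u : ↥(Bᶜ)) (c : (G.induce Bᶜ).Walk u u), c.IsCycle := by
      simpa only [IsAcyclic, not_forall, not_not, exists_prop] using hBa
    obtain ⟨p⟩ := hconn.preconnected b0 u
    obtain ⟨d, -, h1, h2⟩ := p.exists_boundary_dart B hb0 u.2
    exact ⟨⟨d.snd, h2⟩, by simpa [A] using ⟨d.fst, h1, d.adj⟩⟩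
  have hA : ∀ a ∈ A, ((G.induce Bᶜ).induce {a}ᶜ).IsAcyclic := by
    intro a ha
    obtain ⟨b, hb, hab⟩ : ∃ b ∈ B, G.Adj b a := by simpa [A] using ha
    by_contra hcon
    have hmem : B ∪ {b, (a : V)} ∈ P := by
      refine ⟨induce_union_connected hBc.preconnected
        (induce_pair_connected_of_adj hab).preconnected ⟨b, hb, by simp⟩, fun hac => hcon ?_⟩
      have hx : ∀ x : ↥({a}ᶜ : Set ↥(Bᶜ)), x.1.1 ∈ (B ∪ {b, (a : V)})ᶜ := by
        intro x
        have h1 := x.1.2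
        have h2 : x.1 ≠ a := x.2
        rintro (h | h | h)
        · exact h1 h
        · exact h1 (h ▸ hb)
        · exact h2 (Subtype.ext h)
      refine hac.comap (G := (G.induce Bᶜ).induce {a}ᶜ)
        ⟨fun x => ⟨x.1.1, hx x⟩, fun hxy => hxy⟩ ?_
      intro x y hxy
      have : x.1.1 = y.1.1 := Subtype.mk.inj hxy
      exact Subtype.ext (Subtype.ext this)
    have := hB.le_of_ge hmem Set.subset_union_left
    exact a.2 (this (by simp))
  have hd : ∀ v, v ∉ A → 3 ≤ (G.induce Bᶜ).degree v := by
    intro v hv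
    have hv' : ∀ b ∈ B, ¬ G.Adj b v := by simpa [A] using hv
    refine (hdeg' v).trans ?_
    rw [← card_neighborFinset_eq_degree, ← card_neighborFinset_eq_degree]
    rw [← Finset.card_map (Function.Embedding.subtype _) (s := (G.induce Bᶜ).neighborFinset v)]
    refine Finset.card_le_card fun w hw => ?_
    rw [mem_neighborFinset] at hw
    refine Finset.mem_map.2 ⟨⟨w, fun h => hv' w h hw.symm⟩, ?_, rfl⟩
    rw [mem_neighborFinset]
    exact hw
  obtain ⟨u, c, hc, hs, he⟩ := core (G.induce Bᶜ) A hAne hBa hA hd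
  let f := (Embedding.induce (G := G) (Bᶜ : Set V))
  have hsupp : ∀ z, z ∈ (c.map f.toHom).support ↔ z ∉ B := by
    intro z
    rw [Walk.support_map, List.mem_map]
    constructor
    · rintro ⟨x, -, rfl⟩
      exact x.2
    · intro hz
      exact ⟨⟨z, hz⟩, hs _, rfl⟩
  refine ⟨f u, c.map f.toHom, hc.map f.injective, ?_, ?_⟩
  · intro a b ha hb hab
    rw [hsupp] at ha hb
    rw [Walk.edges_map, List.mem_map]
    exact ⟨s(⟨a, ha⟩, ⟨b, hb⟩), he _ _ hab, rfl⟩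
  · have : {z | z ∉ (c.map f.toHom).support} = B := by
      ext z
      have := hsupp z
      simp only [Set.mem_ofPred_eq]
      tauto
    rw [this]
    exact hBc
end

section
/- Every finite simple connected cubic graph (every vertex has degree exactly 3) contains a spanning tree T without three consecutive vertices of degree 2; that is, T contains no path of length 2 all of whose three vertices have degree 2 in T. -/
open SimpleGraph

/-- `H` is a subtree of `G` with vertex set `A`. -/
structure SubT {V : Type} (G H : SimpleGraph V) (A : Set V) : Prop where
  le : H ≤ G
  mem : ∀ x y, H.Adj x y → x ∈ A
  acyc : H.IsAcyclic
  reach : ∀ x ∈ A, ∀ y ∈ A, H.Reachable x y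

/-- Every vertex of `A` is, or is `H`-adjacent to, a vertex all of whose `G`-edges are in `H`. -/
def FullDom {V : Type} (G H : SimpleGraph V) (A : Set V) : Prop :=
  ∀ v ∈ A, ∃ f, (f = v ∨ H.Adj v f) ∧ ∀ w, G.Adj f w → H.Adj f w

theorem SubT.addLeaf {V : Type} {G H : SimpleGraph V} {A : Set V} (h : SubT G H A) {v u : V}
    (hv : v ∈ A) (hu : u ∉ A) (hvu : G.Adj v u) :
    ∃ H', H ≤ H' ∧ H'.Adj v u ∧ SubT G H' (insert u A) ∧
      ∀ x y, H'.Adj x y → H.Adj x y ∨ (x = v ∧ y = u) ∨ (x = u ∧ y = v) := by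
  have hne : v ≠ u := hvu.ne
  have hadj : ∀ x y, (H ⊔ edge v u).Adj x y →
      H.Adj x y ∨ (x = v ∧ y = u) ∨ (x = u ∧ y = v) := by
    intro x y hxy
    rw [sup_adj, edge_adj] at hxy
    tauto
  have hnew : (H ⊔ edge v u).Adj v u := by
    rw [sup_adj, edge_adj]; tauto
  refine ⟨H ⊔ edge v u, le_sup_left, hnew, ⟨?_, ?_, ?_, ?_⟩, hadj⟩
  · intro x y hxy
    rcases hadj x y hxy with h1 | ⟨rfl, rfl⟩ | ⟨rfl, rfl⟩
    · exact h.le h1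
    · exact hvu
    · exact hvu.symm
  · intro x y hxy
    rcases hadj x y hxy with h1 | ⟨rfl, rfl⟩ | ⟨rfl, rfl⟩
    · exact Or.inr (h.mem _ _ h1)
    · exact Or.inr hv
    · exact Or.inl rfl
  · refine IsAcyclic.sup_edge_of_not_reachable ?_ h.acyc
    rintro ⟨p⟩
    obtain ⟨d, -, h1, h2⟩ := p.exists_boundary_dart A hv hu
    exact h2 (h.mem _ _ d.adj.symm)
  · have key : ∀ x ∈ insert u A, (H ⊔ edge v u).Reachable v x := by
      rintro x (rfl | hx)
      · exact hnew.reachable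
      · exact (h.reach v hv x hx).mono le_sup_left
    intro x hx y hy
    exact (key x hx).symm.trans (key y hy)

theorem gdeg_three {V : Type} {G : SimpleGraph V} {w : V} (h : gdeg G w = 3) :
    ∃ x y z, x ≠ y ∧ x ≠ z ∧ y ≠ z ∧ ∀ t, G.Adj w t ↔ t = x ∨ t = y ∨ t = z := by
  have h' : (G.neighborSet w).ncard = 3 := h
  obtain ⟨x, y, z, hxy, hxz, hyz, he⟩ := Set.ncard_eq_three.1 h'
  refine ⟨x, y, z, hxy, hxz, hyz, fun t => ?_⟩
  rw [← mem_neighborSet, he]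
  simp

theorem gdeg_three' {V : Type} {G : SimpleGraph V} {w u : V} (h : gdeg G w = 3)
    (hu : G.Adj w u) :
    ∃ x y, x ≠ y ∧ x ≠ u ∧ y ≠ u ∧ ∀ t, G.Adj w t ↔ t = u ∨ t = x ∨ t = y := by
  obtain ⟨x, y, z, hxy, hxz, hyz, ht⟩ := gdeg_three h
  rcases (ht u).1 hu with rfl | rfl | rfl
  · exact ⟨y, z, hyz, hxy.symm, hxz.symm, ht⟩
  · exact ⟨x, z, hxz, hxy, hyz.symm, fun t => by rw [ht]; tauto⟩
  · exact ⟨x, y, hxy, hxz, hyz, fun t => by rw [ht]; tauto⟩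

/-- Expand a vertex `w` of the subtree with at most one tree edge into a full vertex. -/
theorem SubT.expand {V : Type} {G H : SimpleGraph V} {A : Set V} (h : SubT G H A) {w x y : V}
    (hw : w ∈ A) (hx : x ∉ A) (hy : y ∉ A) (hxy : x ≠ y) (hwx : G.Adj w x) (hwy : G.Adj w y) :
    ∃ H', H ≤ H' ∧ H'.Adj w x ∧ H'.Adj w y ∧ SubT G H' (insert y (insert x A)) := by
  obtain ⟨H1, le1, a1, s1, -⟩ := h.addLeaf hw hx hwx
  have hy' : y ∉ insert x A := by
    rintro (h | h)
    · exact hxy h.symm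
    · exact hy h
  obtain ⟨H2, le2, a2, s2, -⟩ := s1.addLeaf (Or.inr hw) hy' hwy
  exact ⟨H2, le1.trans le2, le2 a1, a2, s2⟩

theorem exists_start {V : Type} (G : SimpleGraph V) (hcubic : ∀ v, gdeg G v = 3) (v : V) :
    ∃ A : Set V, A.Nonempty ∧ ∃ H, SubT G H A ∧ FullDom G H A := by
  obtain ⟨x, y, z, hxy, hxz, hyz, ht⟩ := gdeg_three (hcubic v)
  have s0 : SubT G ⊥ {v} := by
    refine ⟨bot_le, fun x y h => h.elim, isAcyclic_bot, ?_⟩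
    rintro x rfl y rfl
    exact Reachable.refl _
  have hx := (ht x).2 (by simp)
  have hy := (ht y).2 (by simp)
  have hz := (ht z).2 (by simp)
  obtain ⟨H1, -, a1, a2, s1⟩ := s0.expand (w := v) rfl (x := x) (y := y)
    (fun h => hx.ne h.symm) (fun h => hy.ne h.symm) hxy hx hy
  obtain ⟨H2, l2, a3, s2, -⟩ := s1.addLeaf (v := v) (u := z) (by simp)
    (by simp [hxz.symm, hyz.symm, hz.ne.symm]) hz
  have hfull : ∀ w, G.Adj v w → H2.Adj v w := by
    intro w hw
    rcases (ht w).1 hw with rfl | rfl | rfl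
    exacts [l2 a1, l2 a2, a3]
  refine ⟨_, ⟨z, Or.inl rfl⟩, H2, s2, ?_⟩
  rintro t (rfl | rfl | rfl | rfl)
  · exact ⟨v, Or.inr a3.symm, hfull⟩
  · exact ⟨v, Or.inr (l2 a2).symm, hfull⟩
  · exact ⟨v, Or.inr (l2 a1).symm, hfull⟩
  · exact ⟨_, Or.inl rfl, hfull⟩

theorem FullDom.mono {V : Type} {G H H' : SimpleGraph V} {A : Set V} (h : FullDom G H A)
    (hle : H ≤ H') : FullDom G H' A := by
  intro v hv
  obtain ⟨f, h1, h2⟩ := h v hv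
  exact ⟨f, h1.imp id (fun a => hle a), fun w hw => hle (h2 w hw)⟩

theorem exists_grow {V : Type} (G : SimpleGraph V) (hcubic : ∀ v, gdeg G v = 3)
    {H : SimpleGraph V} {A : Set V} (s : SubT G H A) (d : FullDom G H A) {v u w : V}
    (hv : v ∈ A) (hvu : G.Adj v u) (huw : G.Adj u w) (hw : w ∉ A)
    (hwA : ∀ t, G.Adj w t → t ∉ A) :
    ∃ B : Set V, A ⊆ B ∧ w ∈ B ∧ ∃ H', SubT G H' B ∧ FullDom G H' B := by
  have hu : u ∉ A := hwA u huw.symm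
  obtain ⟨x, y, hxy, hxu, hyu, ht⟩ := gdeg_three' (hcubic w) huw.symm
  have hx := (ht x).2 (by simp)
  have hy := (ht y).2 (by simp)
  obtain ⟨H1, l1, a1, s1, -⟩ := s.addLeaf hv hu hvu
  obtain ⟨H2, l2, a2, s2, -⟩ := s1.addLeaf (v := u) (u := w) (by simp)
    (by simp [hw, huw.ne.symm]) huw
  obtain ⟨H3, l3, a3, a4, s3⟩ := s2.expand (w := w) (by simp) (x := x) (y := y)
    (by simp [hx.ne.symm, hxu, hwA x hx]) (by simp [hy.ne.symm, hyu, hwA y hy]) hxy hx hy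
  have hfull : ∀ t, G.Adj w t → H3.Adj w t := by
    intro t h
    rcases (ht t).1 h with rfl | rfl | rfl
    exacts [(l3 a2).symm, a3, a4]
  refine ⟨_, ?_, ?_, H3, s3, ?_⟩
  · intro t ht; simp [ht]
  · simp
  · rintro t (rfl | rfl | rfl | rfl | hA)
    · exact ⟨w, Or.inr a4.symm, hfull⟩
    · exact ⟨w, Or.inr a3.symm, hfull⟩
    · exact ⟨_, Or.inl rfl, hfull⟩
    · exact ⟨w, Or.inr (l3 a2), hfull⟩
    · exact d.mono (l1.trans (l2.trans l3)) t hA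

theorem exists_dominating {V : Type} [Fintype V] (G : SimpleGraph V)
    (hconn : G.Connected) (hcubic : ∀ v, gdeg G v = 3) :
    ∃ (A : Set V) (H : SimpleGraph V), SubT G H A ∧ FullDom G H A ∧
      A.Nonempty ∧ ∀ u, u ∉ A → ∃ v ∈ A, G.Adj v u := by
  obtain ⟨v0⟩ := hconn.nonempty
  obtain ⟨A, hA⟩ := (Set.toFinite {A : Set V | A.Nonempty ∧
    ∃ H, SubT G H A ∧ FullDom G H A}).exists_maximal (exists_start G hcubic v0)
  obtain ⟨⟨hne, H, s, d⟩, hmax⟩ := hA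
  refine ⟨A, H, s, d, hne, ?_⟩
  by_contra! hcon
  obtain ⟨w0, hw0, hw0A⟩ := hcon
  obtain ⟨a0, ha0⟩ := hne
  obtain ⟨p⟩ := hconn.preconnected a0 w0
  obtain ⟨e, -, h1, h2⟩ := p.exists_boundary_dart {t | t ∈ A ∨ ∃ v ∈ A, G.Adj v t}
    (Or.inl ha0) (by
      rintro (h | ⟨v, hv, h⟩)
      · exact hw0 h
      · exact hw0A v hv h)
  have h2a : e.snd ∉ A := fun h => h2 (Or.inl h)
  have h2b : ∀ t, G.Adj e.snd t → t ∉ A := fun t h hA => h2 (Or.inr ⟨t, hA, h.symm⟩)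
  have h1' : ∃ v ∈ A, G.Adj v e.fst := h1.resolve_left (h2b _ e.adj.symm)
  obtain ⟨v, hv, hvu⟩ := h1'
  obtain ⟨B, hAB, hwB, H', s', d'⟩ := exists_grow G hcubic s d hv hvu e.adj h2a h2b
  exact h2a (hmax ⟨⟨a0, hAB ha0⟩, H', s', d'⟩ hAB hwB)

theorem exists_attach {V : Type} [Fintype V] (G : SimpleGraph V)
    {A : Set V} {H : SimpleGraph V} (s : SubT G H A)
    (hdom : ∀ u, u ∉ A → ∃ v ∈ A, G.Adj v u) :
    ∃ T, SubT G T Set.univ ∧ H ≤ T ∧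
      ∀ u, u ∉ A → ∀ x y, T.Adj u x → T.Adj u y → x = y := by
  obtain ⟨B, hB⟩ := (Set.toFinite {B : Set V | A ⊆ B ∧ ∃ T, SubT G T B ∧ H ≤ T ∧
      ∀ u, u ∉ A → ∀ x y, T.Adj u x → T.Adj u y → x = y}).exists_maximal
    ⟨A, subset_rfl, H, s, le_rfl, fun u hu x y h => (hu (s.mem _ _ h)).elim⟩
  obtain ⟨⟨hAB, T, sT, hHT, hT⟩, hmax⟩ := hB
  have : B = Set.univ := by
    by_contra hne
    obtain ⟨u, hu⟩ := (Set.ne_univ_iff_exists_notMem B).1 hne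
    have huA : u ∉ A := fun h => hu (hAB h)
    obtain ⟨v, hv, hvu⟩ := hdom u huA
    obtain ⟨T', l, a, s', had⟩ := sT.addLeaf (hAB hv) hu hvu
    refine hu (hmax ⟨hAB.trans (Set.subset_insert u B), T', s', hHT.trans l, ?_⟩
      (Set.subset_insert u B) (Set.mem_insert u B))
    intro t ht x y h1 h2
    rcases had _ _ h1 with h1 | ⟨rfl, rfl⟩ | ⟨rfl, rfl⟩
    · rcases had _ _ h2 with h2 | ⟨rfl, rfl⟩ | ⟨rfl, rfl⟩
      · exact hT t ht x y h1 h2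
      · exact (ht hv).elim
      · exact (hu (sT.mem _ _ h1)).elim
    · exact (ht hv).elim
    · rcases had _ _ h2 with h2 | ⟨rfl, rfl⟩ | ⟨_, rfl⟩
      · exact (hu (sT.mem _ _ h2)).elim
      · exact (ht hv).elim
      · rfl
  subst this
  exact ⟨T, sT, hHT, hT⟩

/-- Every finite simple connected cubic graph (every vertex has degree exactly 3) contains
a spanning tree `T` without three consecutive vertices of degree 2, i.e. `T` contains no
path of length 2 all of whose three vertices have degree 2 in `T`. -/
theorem stmt_13 (V : Type) [Fintype V] (G : SimpleGraph V)
    (hconn : G.Connected) (hcubic : ∀ v, gdeg G v = 3) :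
    ∃ T : SimpleGraph V, T ≤ G ∧ T.IsTree ∧
      ¬∃ a b c : V, a ≠ c ∧ T.Adj a b ∧ T.Adj b c ∧
        gdeg T a = 2 ∧ gdeg T b = 2 ∧ gdeg T c = 2 := by
  obtain ⟨A, H, s, d, -, hdom⟩ := exists_dominating G hconn hcubic
  obtain ⟨T, sT, hHT, hT⟩ := exists_attach G s hdom
  have := hconn.nonempty
  refine ⟨T, sT.le, ⟨⟨fun x y => sT.reach x trivial y trivial⟩, sT.acyc⟩, ?_⟩
  rintro ⟨a, b, c, hac, hab, hbc, da, db, dc⟩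
  have hbA : b ∈ A := by
    by_contra hb
    exact hac (hT b hb a c hab.symm hbc)
  obtain ⟨f, hf, hfull⟩ := d.mono hHT b hbA
  have hnb : ({a, c} : Set V) = T.neighborSet b := by
    refine Set.eq_of_subset_of_ncard_le ?_ ?_
    · rintro t (rfl | rfl)
      exacts [hab.symm, hbc]
    · rw [Set.ncard_pair hac]
      exact le_of_eq db
  have hf2 : gdeg T f = 2 := by
    rcases hf with rfl | hf
    · exact db
    · have : f ∈ ({a, c} : Set V) := hnb ▸ hf
      rcases this with rfl | rfl
      exacts [da, dc]
  have hEq : T.neighborSet f = G.neighborSet f :=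
    Set.Subset.antisymm (fun t h => sT.le h) (fun t h => hfull t h)
  have h3 := hcubic f
  unfold gdeg at h3 hf2
  rw [hEq] at hf2
  omega
end

section
/- Let G be a finite simple connected graph in which every vertex has degree at most 3. Then G has a spanning tree T such that there is no path of length 2 in T all of whose three vertices have degree 2 in T and degree exactly 3 in G. -/
open SimpleGraph

namespace Grow

variable {V : Type}

/-- Attach all vertices of `W` to `v`. -/
def att (T : SimpleGraph V) (v : V) (W : Set V) : SimpleGraph V :=
  T ⊔ SimpleGraph.fromRel (fun x y => x = v ∧ y ∈ W)

lemma att_adj (T : SimpleGraph V) (v : V) (W : Set V) (hv : v ∉ W) (x y : V) :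
    (att T v W).Adj x y ↔ T.Adj x y ∨ (x = v ∧ y ∈ W) ∨ (y = v ∧ x ∈ W) := by
  simp only [att, sup_adj, fromRel_adj]
  constructor
  · tauto
  · rintro (h | ⟨rfl, h⟩ | ⟨rfl, h⟩)
    · exact Or.inl h
    · exact Or.inr ⟨fun e => hv (e ▸ h), Or.inl ⟨rfl, h⟩⟩
    · exact Or.inr ⟨fun e => hv (e ▸ h), Or.inr ⟨rfl, h⟩⟩

/-- `T` is a subtree of `G` with vertex set `S`. -/
structure Core (G T : SimpleGraph V) (S : Set V) : Prop where
  le : T ≤ G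
  acyc : T.IsAcyclic
  reach : ∀ x ∈ S, ∀ y ∈ S, T.Reachable x y
  mem : ∀ x y, T.Adj x y → x ∈ S

lemma core_attach_one {G T : SimpleGraph V} {S : Set V} (h : Core G T S) {v u : V}
    (hv : v ∈ S) (hu : u ∉ S) (hvu : G.Adj v u) : Core G (T ⊔ edge v u) (insert u S) := by
  have hiso : ∀ y, ¬ T.Adj u y := fun y hy => hu (h.mem _ _ hy)
  have hne : v ≠ u := hvu.ne
  have hadj : (T ⊔ edge v u).Adj v u := by simp [edge_adj, hne]
  have hr : ∀ x ∈ insert u S, (T ⊔ edge v u).Reachable x v := by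
    rintro x (rfl | hx)
    · exact hadj.symm.reachable
    · exact (h.reach x hx v hv).mono le_sup_left
  refine ⟨?_, ?_, ?_, ?_⟩
  · refine sup_le h.le ?_
    intro x y hxy
    rw [edge_adj] at hxy
    rcases hxy with ⟨⟨rfl, rfl⟩ | ⟨rfl, rfl⟩, _⟩
    · exact hvu
    · exact hvu.symm
  · apply IsAcyclic.sup_edge_of_not_reachable _ h.acyc
    rintro ⟨p⟩
    have := p.reverse
    cases this with
    | nil => exact hne rfl
    | cons hh _ => exact hiso _ hh
  · intro x hx y hy
    exact (hr x hx).trans (hr y hy).symm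
  · intro x y hxy
    rw [sup_adj, edge_adj] at hxy
    rcases hxy with hxy | ⟨⟨rfl, rfl⟩ | ⟨rfl, rfl⟩, _⟩
    · exact Or.inr (h.mem _ _ hxy)
    · exact Or.inr hv
    · exact Or.inl rfl

lemma core_att [Finite V] {G T : SimpleGraph V} {S : Set V} (h : Core G T S) {v : V}
    (hv : v ∈ S) (W : Set V) (hW : ∀ w ∈ W, w ∉ S ∧ G.Adj v w) :
    Core G (att T v W) (S ∪ W) := by
  induction W, (Set.toFinite W) using Set.Finite.induction_on with
  | empty =>
    have : att T v ∅ = T := by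
      ext x y; rw [att_adj _ _ _ (by simp)]; simp
    rw [this]; simpa using h
  | @insert u W hu _ ih =>
    have ih' := ih (fun w hw => hW w (Or.inr hw))
    obtain ⟨huS, hvu⟩ := hW u (Or.inl rfl)
    have hvW : v ∉ insert u W := fun hm => (hW v hm).1 hv
    have hvW' : v ∉ W := fun hm => hvW (Or.inr hm)
    have := core_attach_one ih' (v := v) (u := u) (Or.inl hv) (by simp [huS, hu]) hvu
    have e1 : att T v W ⊔ edge v u = att T v (insert u W) := by
      ext x y
      have hne := hvu.ne
      rw [sup_adj, att_adj _ _ _ hvW', att_adj _ _ _ hvW, edge_adj]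
      simp only [Set.mem_insert_iff]
      constructor
      · tauto
      · rintro (h | ⟨rfl, rfl | h⟩ | ⟨rfl, rfl | h⟩)
        · tauto
        · tauto
        · tauto
        · have := hne.symm
          tauto
        · tauto
    have e2 : insert u (S ∪ W) = S ∪ insert u W := by
      ext x; simp only [Set.mem_insert_iff, Set.mem_union]; tauto
    rw [e1, e2] at this
    exact this

/-- Vertices of `S` with a neighbour outside `S`. -/
def Act (G : SimpleGraph V) (S : Set V) (v : V) : Prop :=
  v ∈ S ∧ ∃ w, w ∉ S ∧ G.Adj v w

/-- Tree degree two and graph degree three. -/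
def Bad (G T : SimpleGraph V) (v : V) : Prop := gdeg T v = 2 ∧ gdeg G v = 3

/-- Full expansion of the tree at `v`. -/
def ex (G T : SimpleGraph V) (S : Set V) (v : V) : SimpleGraph V :=
  att T v (G.neighborSet v \ S)

/-- The vertex set of the full expansion at `v`. -/
def exS (G : SimpleGraph V) (S : Set V) (v : V) : Set V :=
  S ∪ (G.neighborSet v \ S)

lemma ex_adj (G T : SimpleGraph V) (S : Set V) (v x y : V) :
    (ex G T S v).Adj x y ↔
      T.Adj x y ∨ (x = v ∧ G.Adj v y ∧ y ∉ S) ∨ (y = v ∧ G.Adj v x ∧ x ∉ S) := by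
  rw [ex, att_adj _ _ _ (by simp)]
  simp

lemma core_ex [Finite V] {G T : SimpleGraph V} {S : Set V} (h : Core G T S) {v : V}
    (hv : v ∈ S) : Core G (ex G T S v) (exS G S v) :=
  core_att h hv _ (fun _ hw => ⟨hw.2, hw.1⟩)

structure Inv0 (G T : SimpleGraph V) (S : Set V) (e : V) : Prop where
  core : Core G T S
  good : ∀ a b c, a ≠ c → T.Adj a b → T.Adj b c → Bad G T a → Bad G T b → Bad G T c → False
  leaf : ∀ x, Act G S x → ∃ p, T.neighborSet x = {p}
  par : ∀ x p, Act G S x → T.Adj x p → ¬ Act G S p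
  nb : ∀ x p, Act G S x → x ≠ e → T.Adj x p → ¬ Bad G T p

structure Inv (G T : SimpleGraph V) (S : Set V) (e : V) : Prop extends Inv0 G T S e where
  exc : ∀ p q, Act G S e → T.Adj e p → T.Adj p q → Bad G T p → ¬ Bad G T q

lemma bad_congr {G T T' : SimpleGraph V} {v : V} (h : T.neighborSet v = T'.neighborSet v) :
    Bad G T v ↔ Bad G T' v := by
  simp [Bad, gdeg, h]

lemma ex_nbr_old {G T : SimpleGraph V} {S : Set V} {v x : V} (hx : x ∈ S) (hxv : x ≠ v) :
    (ex G T S v).neighborSet x = T.neighborSet x := by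
  ext y
  simp only [mem_neighborSet, ex_adj]
  tauto

lemma ex_nbr_new {G T : SimpleGraph V} {S : Set V} (h : Core G T S) {v x : V} (hv : v ∈ S)
    (hx : x ∈ exS G S v) (hxS : x ∉ S) :
    (ex G T S v).neighborSet x = {v} := by
  have hvx : G.Adj v x := by
    rcases hx with hx | hx
    · exact absurd hx hxS
    · exact hx.1
  ext y
  simp only [mem_neighborSet, ex_adj, Set.mem_singleton_iff]
  constructor
  · rintro (h1 | ⟨rfl, _⟩ | ⟨rfl, _⟩)
    · exact absurd (h.mem _ _ h1) hxS
    · exact absurd hv hxS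
    · rfl
  · rintro rfl; exact Or.inr (Or.inr ⟨rfl, hvx, hxS⟩)

lemma not_bad_leaf {G T : SimpleGraph V} {v p : V} (h : T.neighborSet v = {p}) :
    ¬ Bad G T v := by
  simp [Bad, gdeg, h]

lemma not_bad_out {G T : SimpleGraph V} {S : Set V} (h : Core G T S) {v : V} (hv : v ∉ S) :
    ¬ Bad G T v := by
  have : T.neighborSet v = ∅ := by
    ext y; simp only [mem_neighborSet, Set.mem_empty_iff_false, iff_false]
    exact fun hy => hv (h.mem _ _ hy)
  simp [Bad, gdeg, this]

/-- Bad vertices after an expansion, other than `v`, are old and were bad. -/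
lemma bad_ex [Finite V] {G T : SimpleGraph V} {S : Set V} (h : Core G T S) {v x : V} (hv : v ∈ S)
    (hb : Bad G (ex G T S v) x) (hxv : x ≠ v) : x ∈ S ∧ Bad G T x := by
  by_cases hx : x ∈ S
  · exact ⟨hx, (bad_congr (ex_nbr_old hx hxv)).1 hb⟩
  · exfalso
    by_cases hx' : x ∈ exS G S v
    · exact not_bad_leaf (ex_nbr_new h hv hx' hx) hb
    · exact not_bad_out (core_ex h hv) hx' hb

lemma adj_old {G T : SimpleGraph V} {S : Set V} {v x y : V}
    (hx : x ≠ v) (hy : y ≠ v) (h : (ex G T S v).Adj x y) : T.Adj x y := by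
  rw [ex_adj] at h; tauto

lemma adj_oldS {G T : SimpleGraph V} {S : Set V} {v x y : V}
    (hx : x ∈ S) (hy : y ∈ S) (h : (ex G T S v).Adj x y) : T.Adj x y := by
  rw [ex_adj] at h; tauto

lemma act_ex_ne {G : SimpleGraph V} {S : Set V} {v x : V} (h : Act G (exS G S v) x) : x ≠ v := by
  rintro rfl
  obtain ⟨_, w, hw, ha⟩ := h
  apply hw
  by_cases hwS : w ∈ S
  · exact Or.inl hwS
  · exact Or.inr ⟨ha, hwS⟩

lemma act_old {G : SimpleGraph V} {S : Set V} {v x : V} (h : Act G (exS G S v) x) (hx : x ∈ S) :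
    Act G S x := by
  obtain ⟨_, w, hw, ha⟩ := h
  exact ⟨hx, w, fun hh => hw (Or.inl hh), ha⟩

/-- The structural part of the invariant is preserved by expansion. -/
lemma leaf_ex {G T : SimpleGraph V} {S : Set V} {e : V} (h : Inv0 G T S e) {v : V} (hv : v ∈ S) :
    ∀ x, Act G (exS G S v) x → ∃ p, (ex G T S v).neighborSet x = {p} := by
  intro x hx
  by_cases hxS : x ∈ S
  · rw [ex_nbr_old hxS (act_ex_ne hx)]
    exact h.leaf x (act_old hx hxS)
  · exact ⟨v, ex_nbr_new h.core hv hx.1 hxS⟩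

lemma adj_of_act {G T : SimpleGraph V} {S : Set V} {e : V} (h : Inv0 G T S e) {v : V} (hv : v ∈ S)
    {x p : V} (hx : Act G (exS G S v) x) (hp : (ex G T S v).Adj x p) :
    (x ∉ S ∧ p = v) ∨ (x ∈ S ∧ x ≠ v ∧ Act G S x ∧ T.Adj x p) := by
  by_cases hxS : x ∈ S
  · right
    refine ⟨hxS, act_ex_ne hx, act_old hx hxS, ?_⟩
    have : p ∈ (ex G T S v).neighborSet x := hp
    rwa [ex_nbr_old hxS (act_ex_ne hx)] at this
  · left
    have : p ∈ (ex G T S v).neighborSet x := hp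
    rw [ex_nbr_new h.core hv hx.1 hxS] at this
    exact ⟨hxS, this⟩

lemma par_ex {G T : SimpleGraph V} {S : Set V} {e : V} (h : Inv0 G T S e) {v : V} (hv : v ∈ S) :
    ∀ x p, Act G (exS G S v) x → (ex G T S v).Adj x p → ¬ Act G (exS G S v) p := by
  intro x p hx hp hpa
  rcases adj_of_act h hv hx hp with ⟨_, rfl⟩ | ⟨hxS, _, hxa, hT⟩
  · exact act_ex_ne hpa rfl
  · exact h.par x p hxa hT (act_old hpa (h.core.mem _ _ hT.symm))

/-- Expansion at a vertex which is not bad afterwards. -/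
lemma stepA [Finite V] {G T : SimpleGraph V} {S : Set V} {e v : V} (h : Inv0 G T S e)
    (hv : Act G S v) (hnb : ¬ Bad G (ex G T S v) v)
    (hexc : v ≠ e → ∀ p q, Act G S e → T.Adj e p → T.Adj p q → Bad G T p → ¬ Bad G T q) :
    Inv G (ex G T S v) (exS G S v) e := by
  have hvS := hv.1
  have hne : ∀ x, Bad G (ex G T S v) x → x ≠ v := fun x hx e => hnb (e ▸ hx)
  have hold : ∀ x, Bad G (ex G T S v) x → x ∈ S ∧ Bad G T x :=
    fun x hx => bad_ex h.core hvS hx (hne x hx)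
  refine ⟨⟨core_ex h.core hvS, ?_, leaf_ex h hvS, par_ex h hvS, ?_⟩, ?_⟩
  · intro a b c hac hab hbc ha hb hc
    exact h.good a b c hac (adj_oldS (hold a ha).1 (hold b hb).1 hab)
      (adj_oldS (hold b hb).1 (hold c hc).1 hbc) (hold a ha).2 (hold b hb).2 (hold c hc).2
  · intro x p hx hxe hp hb
    rcases adj_of_act h hvS hx hp with ⟨_, rfl⟩ | ⟨hxS, _, hxa, hT⟩
    · exact hnb hb
    · exact h.nb x p hxa hxe hT (hold p hb).2
  · intro p q he hp hpq hbp hbq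
    rcases adj_of_act h hvS he hp with ⟨_, rfl⟩ | ⟨hxS, hev, hxa, hT⟩
    · exact hnb hbp
    · exact hexc hev.symm p q hxa hT (adj_oldS (hold p hbp).1 (hold q hbq).1 hpq)
        (hold p hbp).2 (hold q hbq).2

/-- If `v` becomes bad, then its outside neighbour is unique. -/
lemma unique_out [Finite V] {G T : SimpleGraph V} {S : Set V} {v p : V} (hc : Core G T S)
    (hp : T.neighborSet v = {p}) (hb : Bad G (ex G T S v) v) :
    ∃ u, G.neighborSet v \ S = {u} := by
  have hpS : p ∈ S := by
    have : T.Adj v p := by rw [← mem_neighborSet, hp]; rfl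
    exact hc.mem _ _ this.symm
  have e1 : (ex G T S v).neighborSet v = insert p (G.neighborSet v \ S) := by
    ext y
    have : T.Adj v y ↔ y = p := by rw [← mem_neighborSet, hp]; rfl
    simp only [mem_neighborSet, ex_adj, this, Set.mem_insert_iff, Set.mem_sdiff]
    constructor
    · rintro (h1 | h1 | ⟨rfl, h1, _⟩)
      · exact Or.inl h1
      · exact Or.inr h1.2
      · exact absurd h1 (G.irrefl)
    · rintro (h1 | h1)
      · exact Or.inl h1
      · exact Or.inr (Or.inl ⟨trivial, h1⟩)
  have h2 := hb.1
  rw [gdeg, e1, Nat.card_coe_set_eq, Set.ncard_insert_of_notMem (by simp [hpS])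
    (Set.toFinite _)] at h2
  exact Set.ncard_eq_one.1 (by omega)

/-- Expansion at a vertex with non-bad parent. -/
lemma stepB [Finite V] {G T : SimpleGraph V} {S : Set V} {e v p u : V} (h : Inv0 G T S e)
    (hv : Act G S v) (hp : T.neighborSet v = {p}) (hpb : ¬ Bad G T p)
    (hu : G.neighborSet v \ S = {u})
    (hall : ∀ x q, Act G (exS G S v) x → x ∈ S → T.Adj x q → ¬ Bad G T q) :
    Inv G (ex G T S v) (exS G S v) u := by
  have hvS := hv.1
  have hadj : T.Adj v p := by rw [← mem_neighborSet, hp]; rfl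
  have huu : u ∈ G.neighborSet v \ S := by rw [hu]; rfl
  have hub : ¬ Bad G (ex G T S v) u :=
    not_bad_leaf (ex_nbr_new h.core hvS (Or.inr huu) huu.2)
  have hpb' : ¬ Bad G (ex G T S v) p := fun hb =>
    hpb (bad_ex h.core hvS hb hadj.ne.symm).2
  have hnv : ∀ x, (ex G T S v).Adj v x → ¬ Bad G (ex G T S v) x := by
    intro x hx
    rw [ex_adj] at hx
    rcases hx with hx | ⟨_, hx, hxS⟩ | ⟨rfl, hx, _⟩
    · have : x ∈ T.neighborSet v := hx
      rw [hp] at this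
      rw [Set.mem_singleton_iff.1 this]; exact hpb'
    · have : x ∈ G.neighborSet v \ S := ⟨hx, hxS⟩
      rw [hu] at this
      rw [Set.mem_singleton_iff.1 this]; exact hub
    · exact absurd hx G.irrefl
  refine ⟨⟨core_ex h.core hvS, ?_, leaf_ex h hvS, par_ex h hvS, ?_⟩, ?_⟩
  · intro a b c hac hab hbc ha hb hc
    have hbv : b ≠ v := by rintro rfl; exact hnv a hab.symm ha
    have hav : a ≠ v := by rintro rfl; exact hnv b hab hb
    have hcv : c ≠ v := by rintro rfl; exact hnv b hbc.symm hb
    exact h.good a b c hac (adj_old hav hbv hab) (adj_old hbv hcv hbc)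
      (bad_ex h.core hvS ha hav).2 (bad_ex h.core hvS hb hbv).2 (bad_ex h.core hvS hc hcv).2
  · intro x q hx hxu hq hb
    rcases adj_of_act h hvS hx hq with ⟨hxS, rfl⟩ | ⟨hxS, _, hxa, hT⟩
    · rcases hx.1 with h1 | h1
      · exact hxS h1
      · rw [hu] at h1; exact hxu h1
    · have hqv : q ≠ v := by rintro rfl; exact h.par x q hxa hT hv
      exact hall x q hx hxS hT (bad_ex h.core hvS hb hqv).2
  · intro q r hua hq hqr _ hbr
    have : q ∈ (ex G T S v).neighborSet u := hq
    rw [ex_nbr_new h.core hvS (Or.inr huu) huu.2] at this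
    rw [Set.mem_singleton_iff.1 this] at hqr
    exact hnv r hqr hbr

/-- Expansion at the exceptional vertex. -/
lemma stepC [Finite V] {G T : SimpleGraph V} {S : Set V} {e u : V} (h : Inv G T S e)
    (he : Act G S e) (hu : G.neighborSet e \ S = {u})
    {p : V} (hp : T.neighborSet e = {p}) (hpb : Bad G T p) :
    Inv0 G (ex G T S e) (exS G S e) u := by
  have heS := he.1
  have hadj : T.Adj e p := by rw [← mem_neighborSet, hp]; rfl
  have huu : u ∈ G.neighborSet e \ S := by rw [hu]; rfl
  have hub : ¬ Bad G (ex G T S e) u :=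
    not_bad_leaf (ex_nbr_new h.core heS (Or.inr huu) huu.2)
  have hnv : ∀ x, (ex G T S e).Adj e x → Bad G (ex G T S e) x → x = p := by
    intro x hx hb
    rw [ex_adj] at hx
    rcases hx with hx | ⟨_, hx, hxS⟩ | ⟨rfl, hx, _⟩
    · have : x ∈ T.neighborSet e := hx
      rw [hp] at this
      exact this
    · have : x ∈ G.neighborSet e \ S := ⟨hx, hxS⟩
      rw [hu] at this
      rw [Set.mem_singleton_iff.1 this] at hb; exact absurd hb hub
    · exact absurd hx G.irrefl
  have hpq : ∀ q, q ≠ e → (ex G T S e).Adj p q → ¬ Bad G (ex G T S e) q := by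
    intro q hqe hq hb
    exact h.exc p q he hadj (adj_old hadj.ne.symm hqe hq) hpb (bad_ex h.core heS hb hqe).2
  refine ⟨core_ex h.core heS, ?_, leaf_ex h.toInv0 heS, par_ex h.toInv0 heS, ?_⟩
  · intro a b c hac hab hbc ha hb hc
    have hbv : b ≠ e := by
      rintro rfl
      exact hac ((hnv a hab.symm ha).trans (hnv c hbc hc).symm)
    have hav : a ≠ e := by
      rintro rfl
      have := hnv b hab hb
      subst this
      exact hpq c hac.symm hbc hc
    have hcv : c ≠ e := by
      rintro rfl
      have := hnv b hbc.symm hb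
      subst this
      exact hpq a hac hab.symm ha
    exact h.good a b c hac (adj_old hav hbv hab) (adj_old hbv hcv hbc)
      (bad_ex h.core heS ha hav).2 (bad_ex h.core heS hb hbv).2 (bad_ex h.core heS hc hcv).2
  · intro x q hx hxu hq hb
    rcases adj_of_act h.toInv0 heS hx hq with ⟨hxS, rfl⟩ | ⟨hxS, hxe, hxa, hT⟩
    · rcases hx.1 with h1 | h1
      · exact hxS h1
      · rw [hu] at h1; exact hxu h1
    · have hqv : q ≠ e := by rintro rfl; exact h.par x q hxa hT he
      exact h.nb x q hxa hxe hT (bad_ex h.core heS hb hqv).2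

lemma ssub_exS {G : SimpleGraph V} {S : Set V} {v : V} (h : Act G S v) : S ⊂ exS G S v := by
  obtain ⟨_, w, hw, ha⟩ := h
  exact ⟨Set.subset_union_left, fun hs => hw (hs (Or.inr ⟨ha, hw⟩))⟩

lemma step [Finite V] {G T : SimpleGraph V} {S : Set V} {e v : V} (h : Inv G T S e)
    (hv : Act G S v) : ∃ T' S' e', Inv G T' S' e' ∧ S ⊂ S' := by
  by_cases hA : ∃ x, Act G S x ∧ ¬ Bad G (ex G T S x) x
  · obtain ⟨x, hx, hxb⟩ := hA
    exact ⟨_, _, e, stepA h.toInv0 hx hxb (fun _ => h.exc), ssub_exS hx⟩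
  push Not at hA
  by_cases hE : ∃ p, Act G S e ∧ T.Adj e p ∧ Bad G T p
  swap
  · obtain ⟨p, hp⟩ := h.leaf v hv
    obtain ⟨u, hu⟩ := unique_out h.core hp (hA v hv)
    have key : ∀ x q, Act G S x → T.Adj x q → ¬ Bad G T q := by
      intro x q hx hq hb
      by_cases hxe : x = e
      · subst hxe; exact hE ⟨q, hx, hq, hb⟩
      · exact h.nb x q hx hxe hq hb
    have hadj : T.Adj v p := by rw [← mem_neighborSet, hp]; rfl
    exact ⟨_, _, u, stepB h.toInv0 hv hp (key v p hv hadj) hu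
      (fun x q hx hxS => key x q (act_old hx hxS)), ssub_exS hv⟩
  obtain ⟨p, he, hep, hpb⟩ := hE
  obtain ⟨p', hp'⟩ := h.leaf e he
  have hpp : p = p' := by
    have : p ∈ T.neighborSet e := hep
    rw [hp'] at this; exact this
  subst hpp
  obtain ⟨u, hu⟩ := unique_out h.core hp' (hA e he)
  have huu : u ∈ G.neighborSet e \ S := by rw [hu]; rfl
  have hC := stepC h he hu hp' hpb
  by_cases hua : Act G (exS G S e) u
  swap
  · exact ⟨_, _, u, ⟨hC, fun _ _ hh => absurd hh hua⟩, ssub_exS he⟩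
  by_cases hub : Bad G (ex G (ex G T S e) (exS G S e) u) u
  swap
  · exact ⟨_, _, u, stepA hC hua hub (fun hh => absurd rfl hh),
      (ssub_exS he).trans (ssub_exS hua)⟩
  have hun := ex_nbr_new h.core he.1 hua.1 huu.2
  obtain ⟨u3, hu3⟩ := unique_out hC.core hun hub
  -- the third neighbour
  obtain ⟨w, hw, hwne⟩ : ∃ w ∈ G.neighborSet u, w ∉ ({e, u3} : Set V) := by
    by_contra hcon
    push Not at hcon
    have h1 : (G.neighborSet u).ncard ≤ ({e, u3} : Set V).ncard :=
      Set.ncard_le_ncard hcon (Set.toFinite _)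
    have h2 := Set.ncard_insert_le e {u3}
    rw [Set.ncard_singleton] at h2
    have h3 : (G.neighborSet u).ncard = 3 := hub.2
    omega
  simp only [Set.mem_insert_iff, Set.mem_singleton_iff, not_or] at hwne
  have hwS1 : w ∈ exS G S e := by
    by_contra hcon
    have : w ∈ G.neighborSet u \ exS G S e := ⟨hw, hcon⟩
    rw [hu3] at this
    exact hwne.2 this
  have hwS : w ∈ S := by
    rcases hwS1 with h1 | h1
    · exact h1
    · rw [hu] at h1
      have : w = u := h1
      subst this
      exact absurd hw G.irrefl
  have hwa : Act G S w := ⟨hwS, u, huu.2, SimpleGraph.Adj.symm hw⟩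
  obtain ⟨q, hq⟩ := h.leaf w hwa
  have hwq : T.Adj w q := by rw [← mem_neighborSet, hq]; rfl
  obtain ⟨u', hu'⟩ := unique_out h.core hq (hA w hwa)
  have huu' : u ∈ G.neighborSet w \ S := ⟨SimpleGraph.Adj.symm hw, huu.2⟩
  refine ⟨_, _, u', stepB h.toInv0 hwa hq (h.nb w q hwa hwne.1 hwq) hu' ?_, ssub_exS hwa⟩
  intro x r hx hxS hxr
  apply h.nb x r (act_old hx hxS) _ hxr
  rintro rfl
  obtain ⟨_, y, hy, hxy⟩ := hx
  have : y ∈ G.neighborSet x \ S := ⟨hxy, fun hh => hy (Or.inl hh)⟩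
  rw [hu] at this
  have : y = u := this
  subst this
  exact hy (Or.inr huu')

lemma finish [Finite V] {G : SimpleGraph V} (hconn : G.Connected) :
    ∀ n (T : SimpleGraph V) (S : Set V) (e r : V), r ∈ S → Sᶜ.ncard = n → Inv G T S e →
      ∃ T' e', Inv G T' Set.univ e' := by
  intro n
  induction n using Nat.strong_induction_on with
  | _ n ih =>
    intro T S e r hr hn h
    by_cases hS : S = Set.univ
    · subst hS; exact ⟨T, e, h⟩
    obtain ⟨y, hy⟩ := (Set.ne_univ_iff_exists_notMem S).1 hS
    obtain ⟨w⟩ := hconn.preconnected r y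
    obtain ⟨d, _, hd1, hd2⟩ := w.exists_boundary_dart S hr hy
    obtain ⟨T', S', e', h', hss⟩ := step h (v := d.fst) ⟨hd1, d.snd, hd2, d.adj⟩
    refine ih _ ?_ T' S' e' r (hss.1 hr) rfl h'
    rw [← hn]
    exact Set.ncard_lt_ncard (compl_lt_compl_iff_lt.2 hss) (Set.toFinite _)

lemma start [Finite V] (G : SimpleGraph V) (r : V) :
    Inv G (ex G ⊥ {r} r) (exS G {r} r) r := by
  have hc : Core G (⊥ : SimpleGraph V) {r} := by
    refine ⟨bot_le, isAcyclic_bot, ?_, ?_⟩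
    · rintro x rfl y rfl; exact Reachable.refl _
    · intro x y h; exact absurd h (by simp)
  have hr : r ∈ ({r} : Set V) := rfl
  have hnr : ¬ Bad G (ex G ⊥ {r} r) r := by
    have : (ex G ⊥ {r} r).neighborSet r = G.neighborSet r := by
      ext y
      simp only [mem_neighborSet, ex_adj, bot_adj, false_or, true_and, Set.mem_singleton_iff]
      constructor
      · rintro (h | ⟨_, _, h⟩)
        · exact h.1
        · exact absurd trivial h
      · intro h; exact Or.inl ⟨h, h.ne.symm⟩
    rintro ⟨h1, h2⟩
    rw [gdeg, this] at h1
    rw [gdeg] at h2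
    omega
  have hnb : ∀ x, ¬ Bad G (ex G ⊥ {r} r) x := by
    intro x hx
    by_cases hxr : x = r
    · subst hxr; exact hnr hx
    · exact hxr (bad_ex hc hr hx hxr).1
  have hnew : ∀ x, Act G (exS G {r} r) x → (ex G ⊥ {r} r).neighborSet x = {r} :=
    fun x hx => ex_nbr_new hc hr hx.1 (act_ex_ne hx)
  refine ⟨⟨core_ex hc hr, ?_, fun x hx => ⟨r, hnew x hx⟩, ?_, ?_⟩, ?_⟩
  · intro a b c _ _ _ ha; exact absurd ha (hnb a)
  · intro x p hx hp hpa
    have : p ∈ (ex G ⊥ {r} r).neighborSet x := hp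
    rw [hnew x hx] at this
    exact act_ex_ne hpa this
  · intro x p _ _ _; exact hnb p
  · intro p q _ _ _ hp; exact absurd hp (hnb p)

end Grow

/-- Let `G` be a finite simple connected graph in which every vertex has degree at most 3.
Then `G` has a spanning tree `T` such that there is no path of length 2 in `T` all of whose
three vertices have degree 2 in `T` and degree exactly 3 in `G`. -/
theorem stmt_14 (V : Type) [Fintype V] (G : SimpleGraph V)
    (hconn : G.Connected) (hsub : ∀ v, gdeg G v ≤ 3) :
    ∃ T : SimpleGraph V, T ≤ G ∧ T.IsTree ∧
      ¬∃ a b c : V, a ≠ c ∧ T.Adj a b ∧ T.Adj b c ∧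
        gdeg T a = 2 ∧ gdeg T b = 2 ∧ gdeg T c = 2 ∧
        gdeg G a = 3 ∧ gdeg G b = 3 ∧ gdeg G c = 3 := by
  obtain ⟨r⟩ := hconn.nonempty
  obtain ⟨T, e, h⟩ := Grow.finish hconn _ _ _ r r (Or.inl rfl) rfl (Grow.start G r)
  refine ⟨T, h.core.le, ⟨?_, h.core.acyc⟩, ?_⟩
  · haveI : Nonempty V := ⟨r⟩
    exact ⟨fun x y => h.core.reach x trivial y trivial⟩
  · rintro ⟨a, b, c, hac, hab, hbc, h1, h2, h3, h4, h5, h6⟩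
    exact h.good a b c hac hab hbc ⟨h1, h4⟩ ⟨h2, h5⟩ ⟨h3, h6⟩
end
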